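/- Let l ≥ 2, let C = {x ∈ ℝ^l : x_1 > x_2 > ⋯ > x_l}, let m ∈ ℝ and γ ∈ ℝ, and let f : C → ℝ be a smooth function satisfying Δf(x) + 2m·Σ_{1≤i<j≤l} (∂_i f(x) − ∂_j f(x))/(x_i − x_j) = γ·f(x) for all x ∈ C. Then the complex-valued function ψ : ℝ × C → ℂ defined by ψ(t,x) := e^{iγt/2} · ( ∏_{1≤i<j≤l} (x_i − x_j)^m ) · f(x) is a stationary solution of the rational quantum Calogero–Moser Schrödinger equation: i·∂ψ/∂t (t,x) = −(1/2)·Δ_x ψ(t,x) + m(m−1)·( Σ_{1≤i<j≤l} 1/(x_i − x_j)² )·ψ(t,x) for all (t,x) ∈ ℝ × C. -/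

import Mathlib

open scoped BigOperators

/-- Euclidean Laplacian (real-valued functions): sum of second partial derivatives. -/
noncomputable def eLap {l : ℕ} (f : EuclideanSpace ℝ (Fin l) → ℝ)
    (x : EuclideanSpace ℝ (Fin l)) : ℝ :=
  ∑ i, fderiv ℝ (fun y => fderiv ℝ f y (EuclideanSpace.single i 1)) x
    (EuclideanSpace.single i 1)

/-- Euclidean Laplacian (complex-valued functions). -/
noncomputable def eLapC {l : ℕ} (f : EuclideanSpace ℝ (Fin l) → ℂ)
    (x : EuclideanSpace ℝ (Fin l)) : ℂ :=
  ∑ i, fderiv ℝ (fun y => fderiv ℝ f y (EuclideanSpace.single i 1)) x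
    (EuclideanSpace.single i 1)

/-- The open Weyl chamber `{x ∈ ℝ^l : x₁ > x₂ > ⋯ > x_l}`. -/
def chamber (l : ℕ) : Set (EuclideanSpace ℝ (Fin l)) :=
  {x | ∀ i j : Fin l, i < j → x j < x i}

/-- Interaction sum `∑ⱼ 1/(xᵢ - xⱼ)`; the term `j = i` vanishes since `0⁻¹ = 0`. -/
noncomputable def interaction {l : ℕ} (i : Fin l) (x : EuclideanSpace ℝ (Fin l)) : ℝ :=
  ∑ j, (x i - x j)⁻¹

/-- The weight `∏_{i<j} (xᵢ - xⱼ)^m`. -/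
noncomputable def vandermondeRpow {l : ℕ} (m : ℝ) (x : EuclideanSpace ℝ (Fin l)) : ℝ :=
  ∏ p ∈ Finset.univ.filter (fun p : Fin l × Fin l => p.1 < p.2), (x p.1 - x p.2) ^ m

theorem sum_sum_eq_sum_lt {l : ℕ} (h : Fin l → Fin l → ℝ) (h0 : ∀ i, h i i = 0) :
    ∑ i, ∑ j, h i j = ∑ p ∈ Finset.univ.filter (fun p : Fin l × Fin l => p.1 < p.2),
      (h p.1 p.2 + h p.2 p.1) := by
  have hsplit : ∀ i j, h i j = (if i < j then h i j else 0) + (if j < i then h i j else 0) := by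
    intro i j
    rcases lt_trichotomy i j with hij | rfl | hij
    · simp [hij, hij.not_gt]
    · simp [h0]
    · simp [hij, hij.not_gt]
  rw [Finset.sum_filter, Fintype.sum_prod_type]
  calc ∑ i, ∑ j, h i j
      = ∑ i, ∑ j, (if i < j then h i j else 0) + ∑ i, ∑ j, (if j < i then h i j else 0) := by
        simp_rw [← Finset.sum_add_distrib, ← hsplit]
    _ = ∑ i, ∑ j, (if i < j then h i j else 0) + ∑ i, ∑ j, (if i < j then h j i else 0) := by
        rw [Finset.sum_comm (f := fun i j => if j < i then h i j else 0)]
    _ = _ := by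
        simp_rw [← Finset.sum_add_distrib]
        refine Finset.sum_congr rfl fun i _ => Finset.sum_congr rfl fun j _ => ?_
        split_ifs <;> simp

theorem sum_cyclic {ι : Type*} [Fintype ι] (φ : ι → ι → ι → ℝ) :
    ∑ i, ∑ j, ∑ k, φ j k i = ∑ i, ∑ j, ∑ k, φ i j k := by
  rw [Finset.sum_comm]
  exact Finset.sum_congr rfl fun j _ => Finset.sum_comm

/-- The cross terms of `∑ᵢ (∑ⱼ 1/(xᵢ - xⱼ))²` cancel. -/
theorem sum_sq_sum_inv_sub {ι : Type*} [Fintype ι] (x : ι → ℝ)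
    (hx : Function.Injective x) :
    ∑ i, (∑ j, (x i - x j)⁻¹) ^ 2 = ∑ i, ∑ j, ((x i - x j) ^ 2)⁻¹ := by
  classical
  let φ : ι → ι → ι → ℝ := fun i j k => if j = k then 0 else (x i - x j)⁻¹ * (x i - x k)⁻¹
  have hcancel : ∀ i j k, φ i j k + φ j k i + φ k i j = 0 := by
    intro i j k
    by_cases hij : i = j
    · subst hij; simp [φ]
    by_cases hjk : j = k
    · subst hjk; simp [φ]
    by_cases hki : k = i
    · subst hki; simp [φ]
    have h1 : x i - x j ≠ 0 := sub_ne_zero.2 (hx.ne hij)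
    have h2 : x j - x k ≠ 0 := sub_ne_zero.2 (hx.ne hjk)
    have h3 : x k - x i ≠ 0 := sub_ne_zero.2 (hx.ne hki)
    simp only [φ, if_neg hij, if_neg hjk, if_neg hki]
    rw [← neg_sub (x k) (x i), ← neg_sub (x i) (x j), ← neg_sub (x j) (x k)]
    field_simp
    ring
  have hφ : ∑ i, ∑ j, ∑ k, φ i j k = 0 := by
    have h : ∑ i, ∑ j, ∑ k, (φ i j k + φ j k i + φ k i j) = 0 := by simp [hcancel]
    simp only [Finset.sum_add_distrib] at h
    have h1 := sum_cyclic φ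
    have h2 := sum_cyclic fun i j k => φ j k i
    linarith
  have hsq : ∀ i, (∑ j, (x i - x j)⁻¹) ^ 2
      = ∑ j, ((x i - x j) ^ 2)⁻¹ + ∑ j, ∑ k, φ i j k := by
    intro i
    rw [sq, Finset.sum_mul_sum, ← Finset.sum_add_distrib]
    refine Finset.sum_congr rfl fun j _ => ?_
    have hdiag : ((x i - x j) ^ 2)⁻¹
        = ∑ k, if j = k then (x i - x j)⁻¹ * (x i - x k)⁻¹ else 0 := by
      simp [sq]
    rw [hdiag, ← Finset.sum_add_distrib]
    refine Finset.sum_congr rfl fun k _ => ?_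
    by_cases hjk : j = k <;> simp [φ, hjk]
  simp_rw [hsq, Finset.sum_add_distrib, hφ, add_zero]

theorem isOpen_chamber (l : ℕ) : IsOpen (chamber l) := by
  have h : chamber l = ⋂ i : Fin l, ⋂ j : Fin l, ⋂ _ : i < j, {x | x j < x i} := by
    ext; simp [chamber]
  rw [h]
  refine isOpen_iInter_of_finite fun i => isOpen_iInter_of_finite fun j =>
    isOpen_iInter_of_finite fun _ => isOpen_lt (by fun_prop) (by fun_prop)

theorem injective_of_mem_chamber {l : ℕ} {x : EuclideanSpace ℝ (Fin l)} (hx : x ∈ chamber l) :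
    Function.Injective x := by
  have h : StrictAnti x := fun i j hij => hx i j hij
  exact h.injective

theorem hasFDerivAt_coord_sub {l : ℕ} (i j : Fin l) (x : EuclideanSpace ℝ (Fin l)) :
    HasFDerivAt (fun y : EuclideanSpace ℝ (Fin l) => y i - y j)
      ((EuclideanSpace.proj i : EuclideanSpace ℝ (Fin l) →L[ℝ] ℝ) - EuclideanSpace.proj j) x :=
  ((EuclideanSpace.proj i : EuclideanSpace ℝ (Fin l) →L[ℝ] ℝ)
    - EuclideanSpace.proj j).hasFDerivAt

theorem hasFDerivAt_interaction {l : ℕ} (i : Fin l) {x : EuclideanSpace ℝ (Fin l)}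
    (hx : x ∈ chamber l) :
    HasFDerivAt (interaction i)
      (∑ j, -((x i - x j) ^ 2)⁻¹ •
        ((EuclideanSpace.proj i : EuclideanSpace ℝ (Fin l) →L[ℝ] ℝ) - EuclideanSpace.proj j))
      x := by
  refine HasFDerivAt.fun_sum fun j _ => ?_
  by_cases hij : i = j
  · subst hij
    simpa using hasFDerivAt_const (0 : ℝ) x
  · have hne : x i - x j ≠ 0 := sub_ne_zero.2 ((injective_of_mem_chamber hx).ne hij)
    exact (hasDerivAt_inv hne).comp_hasFDerivAt x (hasFDerivAt_coord_sub i j x)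

theorem fderiv_interaction_single {l : ℕ} (i : Fin l) {x : EuclideanSpace ℝ (Fin l)}
    (hx : x ∈ chamber l) :
    fderiv ℝ (interaction i) x (EuclideanSpace.single i 1) = -∑ j, ((x i - x j) ^ 2)⁻¹ := by
  rw [(hasFDerivAt_interaction i hx).fderiv, sum_apply,
    ← Finset.sum_neg_distrib]
  refine Finset.sum_congr rfl fun j _ => ?_
  by_cases hij : j = i
  · subst hij; simp
  · simp [hij]

theorem hasFDerivAt_vandermondeRpow {l : ℕ} (m : ℝ) {x : EuclideanSpace ℝ (Fin l)}
    (hx : x ∈ chamber l) :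
    HasFDerivAt (vandermondeRpow m)
      (vandermondeRpow m x • m •
        ∑ p ∈ Finset.univ.filter (fun p : Fin l × Fin l => p.1 < p.2), (x p.1 - x p.2)⁻¹ •
          ((EuclideanSpace.proj p.1 : EuclideanSpace ℝ (Fin l) →L[ℝ] ℝ)
            - EuclideanSpace.proj p.2)) x := by
  have hexp : ∀ y ∈ chamber l, vandermondeRpow m y = Real.exp (m *
      ∑ p ∈ Finset.univ.filter (fun p : Fin l × Fin l => p.1 < p.2),
        Real.log (y p.1 - y p.2)) := by
    intro y hy
    rw [Finset.mul_sum, Real.exp_sum]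
    refine Finset.prod_congr rfl fun p hp => ?_
    rw [Real.rpow_def_of_pos (sub_pos.2 (hy _ _ (Finset.mem_filter.1 hp).2)), mul_comm]
  rw [hexp x hx]
  refine HasFDerivAt.congr_of_eventuallyEq ?_
    (Filter.eventuallyEq_of_mem ((isOpen_chamber l).mem_nhds hx) hexp)
  refine (HasFDerivAt.const_mul (HasFDerivAt.fun_sum fun p hp => ?_) m).exp
  exact (hasFDerivAt_coord_sub p.1 p.2 x).log
    (sub_pos.2 (hx _ _ (Finset.mem_filter.1 hp).2)).ne'

theorem fderiv_vandermondeRpow_single {l : ℕ} (m : ℝ) (i : Fin l)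
    {x : EuclideanSpace ℝ (Fin l)} (hx : x ∈ chamber l) :
    fderiv ℝ (vandermondeRpow m) x (EuclideanSpace.single i 1)
      = m * interaction i x * vandermondeRpow m x := by
  have hsum : interaction i x
      = ∑ p ∈ Finset.univ.filter (fun p : Fin l × Fin l => p.1 < p.2), (x p.1 - x p.2)⁻¹ *
          ((if p.1 = i then 1 else 0) - (if p.2 = i then 1 else 0)) := by
    have h := sum_sum_eq_sum_lt
      (fun j k : Fin l => if j = i then (x j - x k)⁻¹ else 0) (by simp)
    rw [Finset.sum_comm] at h
    simp only [Finset.sum_ite_eq', Finset.mem_univ, if_true] at h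
    rw [interaction, h]
    refine Finset.sum_congr rfl fun p _ => ?_
    rw [← neg_sub (x p.1) (x p.2), inv_neg]
    split_ifs <;> ring
  rw [(hasFDerivAt_vandermondeRpow m hx).fderiv, hsum]
  simp [PiLp.single_apply]
  ring

theorem fderiv_const_mul_ofReal {E : Type*} [NormedAddCommGroup E] [NormedSpace ℝ E]
    (c : ℂ) {g : E → ℝ} {x : E} (hg : DifferentiableAt ℝ g x) (v : E) :
    fderiv ℝ (fun y => c * (g y : ℂ)) x v = c * ((fderiv ℝ g x v : ℝ) : ℂ) := by
  have h : HasFDerivAt (fun y => (g y : ℂ)) (Complex.ofRealCLM.comp (fderiv ℝ g x)) x :=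
    Complex.ofRealCLM.hasFDerivAt.comp x hg.hasFDerivAt
  rw [(h.const_mul c).fderiv]
  simp

section

variable {l : ℕ} {m : ℝ} {f : EuclideanSpace ℝ (Fin l) → ℝ} {x : EuclideanSpace ℝ (Fin l)}

theorem fderiv_vandermondeRpow_mul_single (hf : ContDiffOn ℝ (⊤ : ℕ∞) f (chamber l))
    (hx : x ∈ chamber l) (i : Fin l) :
    fderiv ℝ (fun y => vandermondeRpow m y * f y) x (EuclideanSpace.single i 1)
      = m * interaction i x * vandermondeRpow m x * f x
        + vandermondeRpow m x * fderiv ℝ f x (EuclideanSpace.single i 1) := by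
  have hfx : DifferentiableAt ℝ f x :=
    (hf.contDiffAt ((isOpen_chamber l).mem_nhds hx)).differentiableAt (by simp)
  rw [fderiv_fun_mul (hasFDerivAt_vandermondeRpow m hx).differentiableAt hfx]
  simp only [add_apply, smul_apply, smul_eq_mul,
    fderiv_vandermondeRpow_single m i hx]
  ring

theorem differentiableAt_fderiv_apply (hf : ContDiffOn ℝ (⊤ : ℕ∞) f (chamber l))
    (hx : x ∈ chamber l) (v : EuclideanSpace ℝ (Fin l)) :
    DifferentiableAt ℝ (fun y => fderiv ℝ f y v) x := by
  have h : ContDiffAt ℝ 1 (fderiv ℝ f) x :=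
    (hf.contDiffAt ((isOpen_chamber l).mem_nhds hx)).fderiv_right (by
      rw [one_add_one_eq_two]; exact WithTop.coe_le_coe.2 (le_top : (2 : ℕ∞) ≤ ⊤))
  exact (h.differentiableAt (by simp)).clm_apply (differentiableAt_const v)

theorem fderiv_fderiv_vandermondeRpow_mul_single
    (hf : ContDiffOn ℝ (⊤ : ℕ∞) f (chamber l)) (hx : x ∈ chamber l) (i : Fin l) :
    DifferentiableAt ℝ (fun y => fderiv ℝ (fun z => vandermondeRpow m z * f z) y
        (EuclideanSpace.single i 1)) x ∧
    fderiv ℝ (fun y => fderiv ℝ (fun z => vandermondeRpow m z * f z) y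
        (EuclideanSpace.single i 1)) x (EuclideanSpace.single i 1)
      = vandermondeRpow m x *
        (fderiv ℝ (fun y => fderiv ℝ f y (EuclideanSpace.single i 1)) x
            (EuclideanSpace.single i 1)
          + 2 * m * (interaction i x * fderiv ℝ f x (EuclideanSpace.single i 1))
          + (m ^ 2 * interaction i x ^ 2 - m * ∑ j, ((x i - x j) ^ 2)⁻¹) * f x) := by
  have hD := (hasFDerivAt_vandermondeRpow m hx).differentiableAt
  have hg := (hasFDerivAt_interaction i hx).differentiableAt
  have hfx : DifferentiableAt ℝ f x :=
    (hf.contDiffAt ((isOpen_chamber l).mem_nhds hx)).differentiableAt (by simp)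
  have hf' := differentiableAt_fderiv_apply hf hx (EuclideanSpace.single i 1)
  have hF := hD.fun_mul hfx
  have heq : (fun y => fderiv ℝ (fun z => vandermondeRpow m z * f z) y
        (EuclideanSpace.single i 1)) =ᶠ[nhds x]
      fun y => m * (interaction i y * (vandermondeRpow m y * f y))
        + vandermondeRpow m y * fderiv ℝ f y (EuclideanSpace.single i 1) := by
    filter_upwards [(isOpen_chamber l).mem_nhds hx] with y hy
    rw [fderiv_vandermondeRpow_mul_single hf hy]
    ring
  refine ⟨(((hg.fun_mul hF).const_mul m).fun_add (hD.fun_mul hf')).congr_of_eventuallyEq heq, ?_⟩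
  rw [heq.fderiv_eq, fderiv_fun_add ((hg.fun_mul hF).const_mul m) (hD.fun_mul hf'),
    fderiv_const_mul (hg.fun_mul hF), fderiv_fun_mul hg hF, fderiv_fun_mul hD hf']
  simp only [add_apply, smul_apply, smul_eq_mul,
    fderiv_vandermondeRpow_single m i hx, fderiv_interaction_single i hx,
    fderiv_vandermondeRpow_mul_single hf hx]
  ring

/-- Conjugation by `∏_{i<j} (xᵢ - xⱼ)^m` turns the radial operator into a Schrödinger operator
with inverse-square potential. -/
theorem eLap_vandermondeRpow_mul (hf : ContDiffOn ℝ (⊤ : ℕ∞) f (chamber l))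
    (hx : x ∈ chamber l) :
    eLap (fun y => vandermondeRpow m y * f y) x = vandermondeRpow m x *
      (eLap f x + 2 * m *
          ∑ p ∈ Finset.univ.filter (fun p : Fin l × Fin l => p.1 < p.2),
            (fderiv ℝ f x (EuclideanSpace.single p.1 1)
              - fderiv ℝ f x (EuclideanSpace.single p.2 1)) / (x p.1 - x p.2)
        + 2 * (m * (m - 1) * ∑ p ∈ Finset.univ.filter (fun p : Fin l × Fin l => p.1 < p.2),
            1 / (x p.1 - x p.2) ^ 2) * f x) := by
  have hdrift : ∑ p ∈ Finset.univ.filter (fun p : Fin l × Fin l => p.1 < p.2),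
        (fderiv ℝ f x (EuclideanSpace.single p.1 1)
          - fderiv ℝ f x (EuclideanSpace.single p.2 1)) / (x p.1 - x p.2)
      = ∑ i, interaction i x * fderiv ℝ f x (EuclideanSpace.single i 1) := by
    simp_rw [interaction, Finset.sum_mul]
    rw [sum_sum_eq_sum_lt _ (by simp)]
    refine Finset.sum_congr rfl fun p _ => ?_
    rw [← neg_sub (x p.1) (x p.2), inv_neg]
    ring
  have hpot : ∑ i, ∑ j, ((x i - x j) ^ 2)⁻¹
      = 2 * ∑ p ∈ Finset.univ.filter (fun p : Fin l × Fin l => p.1 < p.2),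
          1 / (x p.1 - x p.2) ^ 2 := by
    rw [sum_sum_eq_sum_lt _ (by simp), Finset.mul_sum]
    refine Finset.sum_congr rfl fun p _ => ?_
    rw [← neg_sub (x p.1) (x p.2), neg_sq]
    ring
  have hsq : ∑ i, interaction i x ^ 2 = ∑ i, ∑ j, ((x i - x j) ^ 2)⁻¹ :=
    sum_sq_sum_inv_sub x (injective_of_mem_chamber hx)
  simp_rw [eLap, (fderiv_fderiv_vandermondeRpow_mul_single hf hx _).2]
  rw [← Finset.mul_sum, Finset.sum_add_distrib, Finset.sum_add_distrib, ← Finset.mul_sum,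
    ← Finset.sum_mul, Finset.sum_sub_distrib, ← Finset.mul_sum, ← Finset.mul_sum, hsq, hpot,
    hdrift]
  ring

theorem eLapC_const_mul_vandermondeRpow_mul (c : ℂ)
    (hf : ContDiffOn ℝ (⊤ : ℕ∞) f (chamber l)) (hx : x ∈ chamber l) :
    eLapC (fun y => c * ((vandermondeRpow m y * f y : ℝ) : ℂ)) x
      = c * ((eLap (fun y => vandermondeRpow m y * f y) x : ℝ) : ℂ) := by
  rw [eLapC, eLap, Complex.ofReal_sum, Finset.mul_sum]
  refine Finset.sum_congr rfl fun i _ => ?_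
  rw [← fderiv_const_mul_ofReal c (fderiv_fderiv_vandermondeRpow_mul_single hf hx i).1]
  refine DFunLike.congr_fun (Filter.EventuallyEq.fderiv_eq ?_) _
  filter_upwards [(isOpen_chamber l).mem_nhds hx] with y hy
  have hfy : DifferentiableAt ℝ f y :=
    (hf.contDiffAt ((isOpen_chamber l).mem_nhds hy)).differentiableAt (by simp)
  exact fderiv_const_mul_ofReal c
    ((hasFDerivAt_vandermondeRpow m hy).differentiableAt.fun_mul hfy) _

end

/-- If `f` is an eigenfunction (with eigenvalue `γ`) of the radial operator
`Δ + 2m ∑_{i<j}(∂_i - ∂_j)/(x_i - x_j)` on the open Weyl chamber, then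
`ψ(t,x) = e^{iγt/2} ∏_{i<j}(x_i - x_j)^m f(x)` is a stationary solution of the rational
quantum Calogero–Moser Schrödinger equation
`i ∂ψ/∂t = -(1/2)Δψ + m(m-1)(∑_{i<j}(x_i - x_j)^{-2})ψ`. -/
theorem stmt10 {l : ℕ} (hl : 2 ≤ l) (m γ : ℝ)
    (f : EuclideanSpace ℝ (Fin l) → ℝ) (hf : ContDiffOn ℝ (⊤ : ℕ∞) f (chamber l))
    (heig : ∀ x ∈ chamber l,
      eLap f x + 2 * m *
          ∑ p ∈ Finset.univ.filter (fun p : Fin l × Fin l => p.1 < p.2),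
            (fderiv ℝ f x (EuclideanSpace.single p.1 1)
              - fderiv ℝ f x (EuclideanSpace.single p.2 1)) / (x p.1 - x p.2)
        = γ * f x)
    (ψ : ℝ → EuclideanSpace ℝ (Fin l) → ℂ)
    (hψ : ψ = fun (t : ℝ) x => Complex.exp (Complex.I * (γ : ℂ) * (t : ℂ) / 2)
        * ((∏ p ∈ Finset.univ.filter (fun p : Fin l × Fin l => p.1 < p.2),
              (x p.1 - x p.2) ^ m : ℝ) : ℂ) * (f x : ℂ)) :
    ∀ t : ℝ, ∀ x ∈ chamber l,
      Complex.I * deriv (fun s => ψ s x) t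
        = -(1/2 : ℂ) * eLapC (fun y => ψ t y) x
          + ((m * (m - 1)
              * ∑ p ∈ Finset.univ.filter (fun p : Fin l × Fin l => p.1 < p.2),
                  1 / (x p.1 - x p.2) ^ 2 : ℝ) : ℂ) * ψ t x := by
  intro t x hx
  have hψ' : ∀ s y, ψ s y = Complex.exp (Complex.I * (γ : ℂ) * (s : ℂ) / 2)
      * ((vandermondeRpow m y * f y : ℝ) : ℂ) := by
    intro s y
    rw [hψ, Complex.ofReal_mul, ← mul_assoc]
    rfl
  have hderiv : HasDerivAt (fun s : ℝ => ψ s x) (Complex.I * γ / 2 * ψ t x) t := by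
    have hlin : HasDerivAt (fun s : ℝ => Complex.I * (γ : ℂ) * (s : ℂ) / 2)
        (Complex.I * γ / 2) t := by
      simpa using ((Complex.ofRealCLM.hasDerivAt (x := t)).const_mul
        (Complex.I * (γ : ℂ))).div_const 2
    have h := hlin.cexp.mul_const ((vandermondeRpow m x * f x : ℝ) : ℂ)
    simp_rw [hψ']
    exact h.congr_deriv (by ring)
  have hlap : eLapC (fun y => ψ t y) x = (γ + 2 * ((m * (m - 1)
      * ∑ p ∈ Finset.univ.filter (fun p : Fin l × Fin l => p.1 < p.2),
          1 / (x p.1 - x p.2) ^ 2 : ℝ) : ℂ)) * ψ t x := by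
    simp_rw [hψ']
    rw [eLapC_const_mul_vandermondeRpow_mul _ hf hx, eLap_vandermondeRpow_mul hf hx, heig x hx]
    push_cast
    ring
  rw [hderiv.deriv, hlap]
  linear_combination (γ / 2 * ψ t x) * Complex.I_mul_I
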